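/- arXiv:1707.06708 — 8 statements merged into one kernel-verified Lean document; each statement's English description precedes it below -/
import Mathlib

section
/- Let K be an imaginary quadratic field with ring of integers 𝒪_K, and let q be a positive integer. Then there exists a finite set F ⊆ SL(2, K) such that for every γ ∈ SL(2, K) all of whose entries lie in (1/q)·𝒪_K, there is some δ ∈ F such that every entry of γ·δ⁻¹ lies in 𝒪_K. -/
open NumberField

/-- The entries of the inverse of a matrix in `SL(2, K)` with entries in `(1/q)·𝓞 K` lie in
`(1/q)·𝓞 K`. -/
theorem exists_inv_apply_eq_div {K : Type*} [Field K] {q : K}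
    {δ : Matrix.SpecialLinearGroup (Fin 2) K}
    (hδ : ∀ i j, ∃ r : 𝓞 K, (δ : Matrix (Fin 2) (Fin 2) K) i j = (r : K) / q) (i j : Fin 2) :
    ∃ r : 𝓞 K, ((δ⁻¹ : Matrix.SpecialLinearGroup (Fin 2) K) : Matrix (Fin 2) (Fin 2) K) i j =
      (r : K) / q := by
  obtain ⟨a, ha⟩ := hδ 0 0
  obtain ⟨b, hb⟩ := hδ 0 1
  obtain ⟨c, hc⟩ := hδ 1 0
  obtain ⟨d, hd⟩ := hδ 1 1
  rw [Matrix.SpecialLinearGroup.coe_inv, Matrix.adjugate_fin_two, ha, hb, hc, hd]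
  fin_cases i <;> fin_cases j
  · exact ⟨d, rfl⟩
  · exact ⟨-b, by simp [neg_div]⟩
  · exact ⟨-c, by simp [neg_div]⟩
  · exact ⟨a, rfl⟩

/-- If the entries of `γ - δ` lie in `q·𝓞 K` and those of `δ` in `(1/q)·𝓞 K`, then
`γ * δ⁻¹ = 1 + (γ - δ) * δ⁻¹` is integral. -/
theorem exists_mul_inv_apply_eq_of_sub {K : Type*} [Field K] {q : K} (hq : q ≠ 0)
    {γ δ : Matrix.SpecialLinearGroup (Fin 2) K}
    (hδ : ∀ i j, ∃ r : 𝓞 K, (δ : Matrix (Fin 2) (Fin 2) K) i j = (r : K) / q)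
    (hγδ : ∀ i j, ∃ x : 𝓞 K, (γ : Matrix (Fin 2) (Fin 2) K) i j =
      (δ : Matrix (Fin 2) (Fin 2) K) i j + q * x) (i j : Fin 2) :
    ∃ r : 𝓞 K, ((γ * δ⁻¹ : Matrix.SpecialLinearGroup (Fin 2) K) :
      Matrix (Fin 2) (Fin 2) K) i j = (r : K) := by
  choose x hx using hγδ
  choose s hs using exists_inv_apply_eq_div hδ
  obtain ⟨e, he⟩ : ∃ e : 𝓞 K, (1 : Matrix (Fin 2) (Fin 2) K) i j = algebraMap (𝓞 K) K e :=
    ⟨if i = j then 1 else 0, by rw [Matrix.one_apply]; split_ifs <;> simp⟩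
  have hsub : ((γ : Matrix (Fin 2) (Fin 2) K) - δ) *
      ((δ⁻¹ : Matrix.SpecialLinearGroup (Fin 2) K) : Matrix (Fin 2) (Fin 2) K) =
      ((γ * δ⁻¹ : Matrix.SpecialLinearGroup (Fin 2) K) : Matrix (Fin 2) (Fin 2) K) - 1 := by
    rw [sub_mul, ← Matrix.SpecialLinearGroup.coe_mul, ← Matrix.SpecialLinearGroup.coe_mul,
      mul_inv_cancel, Matrix.SpecialLinearGroup.coe_one]
  have hentry := congrFun₂ hsub i j
  rw [Matrix.sub_apply _ 1, he, eq_sub_iff_add_eq] at hentry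
  refine ⟨∑ k, x i k * s k j + e, hentry.symm.trans ?_⟩
  change _ = algebraMap (𝓞 K) K _
  rw [map_add, map_sum, Matrix.mul_apply]
  refine congrArg (· + _) (Finset.sum_congr rfl fun k _ ↦ ?_)
  rw [Matrix.sub_apply, hx, hs, map_mul, add_sub_cancel_left]
  field_simp

/-- Over an imaginary quadratic field `K`, the matrices in `SL(2, K)` whose
entries have denominator dividing `q` are covered by finitely many right cosets of the
integral matrices. -/
theorem finitely_many_cosets_of_bounded_denominator
    (K : Type*) [Field K] [NumberField K]
    (hdeg : Module.finrank ℚ K = 2)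
    (himag : IsEmpty (K →+* ℝ))
    (q : ℕ) (hq : 0 < q) :
    ∃ F : Finset (Matrix.SpecialLinearGroup (Fin 2) K),
      ∀ γ : Matrix.SpecialLinearGroup (Fin 2) K,
        (∀ i j, ∃ r : 𝓞 K, (γ : Matrix (Fin 2) (Fin 2) K) i j = (r : K) / q) →
        ∃ δ ∈ F, ∀ i j, ∃ r : 𝓞 K,
          ((γ * δ⁻¹ : Matrix.SpecialLinearGroup (Fin 2) K) :
              Matrix (Fin 2) (Fin 2) K) i j = (r : K) := by
  classical
  have hqK : (q : K) ≠ 0 := Nat.cast_ne_zero.mpr hq.ne'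
  let I : Ideal (𝓞 K) := Ideal.span {(q : 𝓞 K) ^ 2}
  have hI : I ≠ ⊥ := by
    rw [Ne, Ideal.span_singleton_eq_bot]
    exact pow_ne_zero 2 (Nat.cast_ne_zero.mpr hq.ne')
  have : Finite (𝓞 K ⧸ I) := Ideal.finiteQuotientOfFreeOfNeBot I hI
  let S := {γ : Matrix.SpecialLinearGroup (Fin 2) K //
    ∀ i j, ∃ r : 𝓞 K, (γ : Matrix (Fin 2) (Fin 2) K) i j = (r : K) / q}
  choose num hnum using fun γ : S ↦ γ.2
  let residue : S → Fin 2 → Fin 2 → 𝓞 K ⧸ I := fun γ i j ↦ Ideal.Quotient.mk I (num γ i j)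
  let rep : Set.range residue → S := fun c ↦ c.2.choose
  have hrep (c : Set.range residue) : residue (rep c) = c := c.2.choose_spec
  refine ⟨(Set.finite_range fun c ↦ (rep c : Matrix.SpecialLinearGroup (Fin 2) K)).toFinset,
    fun γ hγ ↦ ?_⟩
  let c : Set.range residue := ⟨residue ⟨γ, hγ⟩, ⟨γ, hγ⟩, rfl⟩
  refine ⟨rep c, by simp, exists_mul_inv_apply_eq_of_sub hqK (rep c).2 fun i j ↦ ?_⟩
  have hmem : num ⟨γ, hγ⟩ i j - num (rep c) i j ∈ I :=
    Ideal.Quotient.eq.mp (congrFun₂ (hrep c) i j).symm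
  obtain ⟨x, hx⟩ := Ideal.mem_span_singleton.mp hmem
  refine ⟨x, ?_⟩
  rw [hnum ⟨γ, hγ⟩ i j, hnum (rep c) i j, sub_eq_iff_eq_add.mp hx]
  push_cast
  field_simp
  simp [add_comm]
end

section
/- Let K be a number field with [K:ℚ] = 2, let σ be the nontrivial ℚ-algebra automorphism of K, and let 𝒪_K be the ring of integers of K. Let C, D ∈ 𝒪_K and let e be a positive integer such that e divides each of C·σ(C), C·σ(D) + σ(C)·D, and D·σ(D) (these three elements are rational integers, being fixed by σ). Then e divides the absolute norm of the ideal of 𝒪_K generated by C and D. -/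
open NumberField

/-- In a quadratic extension, the norm of `x` is the product of `x` and its conjugate. -/
theorem NumberField.RingOfIntegers.coe_norm_int_eq_mul_conj {K : Type*} [Field K] [NumberField K]
    (hdeg : Module.finrank ℚ K = 2) (σ : K ≃ₐ[ℚ] K) (hσ : σ ≠ AlgEquiv.refl) (x : 𝓞 K) :
    ((Algebra.norm ℤ x : ℤ) : K) = (x : K) * σ (x : K) := by
  classical
  have : Algebra.IsQuadraticExtension ℚ K := ⟨hdeg⟩
  have huniv : (Finset.univ : Finset (K ≃ₐ[ℚ] K)) = {AlgEquiv.refl, σ} := by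
    refine (Finset.eq_of_subset_of_card_le (Finset.subset_univ _) ?_).symm
    rw [Finset.card_univ, ← Nat.card_eq_fintype_card, IsGalois.card_aut_eq_finrank, hdeg,
      Finset.card_pair hσ.symm]
  have h := Algebra.norm_eq_prod_automorphisms ℚ (x : K)
  rw [huniv, Finset.prod_pair hσ.symm, ← Algebra.coe_norm_int] at h
  simpa using h

/-- An element whose trace is divisible by `e` and whose norm is divisible by `e ^ 2`
is `e` times an integral element. -/
theorem exists_isIntegral_eq_mul_of_add_of_mul {K : Type*} [Field K] [CharZero K]
    {e : ℕ} (he : 0 < e) {a b : K} {t n : ℤ} (hadd : a + b = e * t) (hmul : a * b = e ^ 2 * n) :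
    ∃ w : K, IsIntegral ℤ w ∧ a = e * w := by
  have he' : (e : K) ≠ 0 := by exact_mod_cast he.ne'
  refine ⟨a / e, ⟨Polynomial.X ^ 2 - Polynomial.C t * Polynomial.X + Polynomial.C n,
    by monicity!, ?_⟩, by field_simp⟩
  simp only [Polynomial.eval₂_add, Polynomial.eval₂_sub, Polynomial.eval₂_mul,
    Polynomial.eval₂_pow, Polynomial.eval₂_X, Polynomial.eval₂_C, algebraMap_int_eq, Int.coe_castRingHom]
  field_simp
  linear_combination a * hadd - hmul

/-- A rational integer that is `e` times an integral element is divisible by `e`. -/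
theorem Int.natCast_dvd_of_eq_mul_isIntegral {K : Type*} [Field K] [CharZero K]
    {e : ℕ} (he : 0 < e) {n : ℤ} {w : K} (hw : IsIntegral ℤ w) (h : (n : K) = e * w) :
    (e : ℤ) ∣ n := by
  have he' : (e : K) ≠ 0 := by exact_mod_cast he.ne'
  have hq : (e : ℚ) ≠ 0 := by exact_mod_cast he.ne'
  have hmap : algebraMap ℚ K (n / e) = w := by
    simp [h, he']
  rw [← hmap, isIntegral_algebraMap_iff (algebraMap ℚ K).injective,
    IsIntegrallyClosed.isIntegral_iff] at hw
  obtain ⟨m, hm⟩ := hw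
  refine ⟨m, ?_⟩
  rw [eq_div_iff hq, eq_intCast] at hm
  rw [mul_comm]
  exact_mod_cast hm.symm

/-- Let `K` be a quadratic number field with nontrivial automorphism `σ`, and
`C, D ∈ 𝒪_K`.  If a positive integer `e` divides each of the rational integers `C·σ(C)`,
`C·σ(D) + σ(C)·D` and `D·σ(D)`, then `e` divides the absolute norm of the ideal `(C, D)`. -/
theorem dvd_absNorm_of_dvd_form_coeffs
    (K : Type*) [Field K] [NumberField K]
    (hdeg : Module.finrank ℚ K = 2)
    (σ : K ≃ₐ[ℚ] K) (hσ : σ ≠ AlgEquiv.refl)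
    (C D : 𝓞 K) (e : ℕ) (he : 0 < e)
    (h₁ : ∃ z : ℤ, (C : K) * σ (C : K) = (e : K) * (z : K))
    (h₂ : ∃ z : ℤ, (C : K) * σ (D : K) + σ (C : K) * (D : K) = (e : K) * (z : K))
    (h₃ : ∃ z : ℤ, (D : K) * σ (D : K) = (e : K) * (z : K)) :
    e ∣ Ideal.absNorm (Ideal.span {C, D} : Ideal (𝓞 K)) := by
  obtain ⟨z₁, h₁⟩ := h₁
  obtain ⟨z₂, h₂⟩ := h₂
  obtain ⟨z₃, h₃⟩ := h₃
  obtain ⟨v, hv, hCD⟩ := exists_isIntegral_eq_mul_of_add_of_mul (n := z₁ * z₃) he h₂ (by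
    push_cast
    linear_combination (D : K) * σ D * h₁ + e * z₁ * h₃)
  obtain ⟨w, hw, hDC⟩ := exists_isIntegral_eq_mul_of_add_of_mul (n := z₁ * z₃) he
    ((add_comm _ _).trans h₂) (by
      push_cast
      linear_combination (D : K) * σ D * h₁ + e * z₁ * h₃)
  rw [← Int.natCast_dvd_natCast, ← Ideal.mem_span_singleton, ← Ideal.span_singleton_le_iff_mem,
    ← Ideal.relNorm_int, ← Ideal.spanNorm_eq, Ideal.spanNorm, Ideal.map, Ideal.span_le]
  rintro _ ⟨x, hx, rfl⟩
  obtain ⟨a, b, rfl⟩ := Ideal.mem_span_pair.mp hx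
  rw [SetLike.mem_coe, Ideal.mem_span_singleton, Algebra.intNorm_eq_norm]
  have hσint (y : 𝓞 K) : IsIntegral ℤ (σ (y : K)) :=
    y.isIntegral_coe.map (σ.toAlgHom.restrictScalars ℤ)
  refine Int.natCast_dvd_of_eq_mul_isIntegral (K := K) he
    (w := a * σ a * z₁ + a * σ b * v + σ a * b * w + b * σ b * z₃) ?_ ?_
  · have ha := a.isIntegral_coe
    have hb := b.isIntegral_coe
    have hz (z : ℤ) : IsIntegral ℤ (z : K) := isIntegral_algebraMap
    exact ((((ha.mul (hσint a)).mul (hz z₁)).add ((ha.mul (hσint b)).mul hv)).add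
      (((hσint a).mul hb).mul hw)).add ((hb.mul (hσint b)).mul (hz z₃))
  · rw [RingOfIntegers.coe_norm_int_eq_mul_conj hdeg σ hσ]
    simp only [map_add, map_mul]
    linear_combination (a : K) * σ a * h₁ + a * σ b * hCD + σ a * b * hDC + b * σ b * h₃
end

section
/- Let K be a number field with [K:ℚ] = 2, let σ be the nontrivial ℚ-algebra automorphism of K, and let 𝒪_K be the ring of integers of K. Let C, D ∈ 𝒪_K and let d₁ be a positive integer such that d₁² (viewed in 𝒪_K) lies in the ideal generated by C and D. If e is a positive integer dividing each of C·σ(C), C·σ(D) + σ(C)·D, and D·σ(D) (these three elements are rational integers), then e divides d₁⁴. -/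
open NumberField

/-- If the sum and the product of two elements are integral, so is each of them. -/
theorem isIntegral_of_add_of_mul {R A : Type*} [CommRing R] [CommRing A] [Algebra R A] {x y : A}
    (hadd : IsIntegral R (x + y)) (hmul : IsIntegral R (x * y)) : IsIntegral R x := by
  let S := integralClosure R A
  let s : S := ⟨x + y, hadd⟩
  let t : S := ⟨x * y, hmul⟩
  refine isIntegral_trans (A := S) x
    ⟨Polynomial.X ^ 2 - Polynomial.C s * Polynomial.X + Polynomial.C t, ?_, ?_⟩
  · monicity!
  · have hs : algebraMap S A s = x + y := rfl
    have ht : algebraMap S A t = x * y := rfl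
    simp only [Polynomial.eval₂_add, Polynomial.eval₂_sub, Polynomial.eval₂_mul,
      Polynomial.eval₂_pow, Polynomial.eval₂_X, Polynomial.eval₂_C, hs, ht]
    ring

/-- A natural number whose quotient by `e` is integral over `ℤ` is divisible by `e`. -/
theorem Nat.dvd_of_isIntegral_div {K : Type*} [Field K] [CharZero K] {e n : ℕ} (he : e ≠ 0)
    (h : IsIntegral ℤ ((n : K) / (e : K))) : e ∣ n := by
  have hq : IsIntegral ℤ ((n : ℚ) / (e : ℚ)) := by
    rw [← isIntegral_algebraMap_iff (algebraMap ℚ K).injective]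
    simpa using h
  obtain ⟨m, hm⟩ := IsIntegrallyClosed.isIntegral_iff.mp hq
  have he' : (e : ℚ) ≠ 0 := by exact_mod_cast he
  have key : (n : ℤ) = e * m := by
    rw [eq_intCast, eq_div_iff he'] at hm
    have : (n : ℚ) = e * m := by rw [← hm, mul_comm]
    exact_mod_cast this
  exact Int.natCast_dvd_natCast.mp ⟨m, key⟩

/-- Let `K` be a quadratic number field with nontrivial automorphism `σ`, and
`C, D ∈ 𝒪_K` with `d₁² ∈ (C, D)` for a positive integer `d₁`.  If a positive integer `e`
divides each of the rational integers `C·σ(C)`, `C·σ(D) + σ(C)·D` and `D·σ(D)`, then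
`e` divides `d₁⁴`. -/
theorem dvd_pow_four_of_dvd_form_coeffs
    (K : Type*) [Field K] [NumberField K]
    (hdeg : Module.finrank ℚ K = 2)
    (σ : K ≃ₐ[ℚ] K) (hσ : σ ≠ AlgEquiv.refl)
    (C D : 𝓞 K) (d₁ : ℕ) (hd₁ : 0 < d₁)
    (hmem : ((d₁ : 𝓞 K)) ^ 2 ∈ (Ideal.span {C, D} : Ideal (𝓞 K)))
    (e : ℕ) (he : 0 < e)
    (h₁ : ∃ z : ℤ, (C : K) * σ (C : K) = (e : K) * (z : K))
    (h₂ : ∃ z : ℤ, (C : K) * σ (D : K) + σ (C : K) * (D : K) = (e : K) * (z : K))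
    (h₃ : ∃ z : ℤ, (D : K) * σ (D : K) = (e : K) * (z : K)) :
    e ∣ d₁ ^ 4 := by
  obtain ⟨z₁, h₁⟩ := h₁
  obtain ⟨z₂, h₂⟩ := h₂
  obtain ⟨z₃, h₃⟩ := h₃
  obtain ⟨a, b, hab⟩ := Ideal.mem_span_pair.mp hmem
  have heK : (e : K) ≠ 0 := by exact_mod_cast he.ne'
  have hab' : (a : K) * C + b * D = (d₁ : K) ^ 2 := by
    simpa using congrArg (algebraMap (𝓞 K) K) hab
  have hσab : σ (a : K) * σ (C : K) + σ (b : K) * σ (D : K) = (d₁ : K) ^ 2 := by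
    simpa using congrArg σ hab'
  have hint (z : ℤ) : IsIntegral ℤ (z : K) := isIntegral_algebraMap (R := ℤ) (x := z)
  have hσint (x : 𝓞 K) : IsIntegral ℤ (σ (x : K)) := map_isIntegral_int σ x.isIntegral_coe
  have hadd : (C : K) * σ (D : K) / e + σ (C : K) * D / e = z₂ := by
    rw [← add_div, h₂, mul_div_cancel_left₀ _ heK]
  have hmul : (C : K) * σ (D : K) / e * (σ (C : K) * D / e) = (z₁ : K) * z₃ := by
    field_simp
    linear_combination (D : K) * σ (D : K) * h₁ + (e : K) * z₁ * h₃
  have hx : IsIntegral ℤ ((C : K) * σ (D : K) / e) :=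
    isIntegral_of_add_of_mul (hadd ▸ hint z₂) (hmul ▸ (hint z₁).mul (hint z₃))
  have hy : IsIntegral ℤ (σ (C : K) * (D : K) / e) :=
    isIntegral_of_add_of_mul (by rw [add_comm, hadd]; exact hint z₂)
      (by rw [mul_comm, hmul]; exact (hint z₁).mul (hint z₃))
  refine Nat.dvd_of_isIntegral_div (K := K) he.ne' ?_
  have key : ((d₁ ^ 4 : ℕ) : K) / e =
      (a : K) * σ (a : K) * z₁ + (a : K) * σ (b : K) * ((C : K) * σ (D : K) / e)
        + (b : K) * σ (a : K) * (σ (C : K) * (D : K) / e) + (b : K) * σ (b : K) * z₃ := by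
    push_cast
    field_simp
    linear_combination (a : K) * σ (a : K) * h₁ + (b : K) * σ (b : K) * h₃
      - (d₁ : K) ^ 2 * hab' - ((a : K) * C + b * D) * hσab
  rw [key]
  exact (((((a.isIntegral_coe.mul (hσint a)).mul (hint z₁)).add
    ((a.isIntegral_coe.mul (hσint b)).mul hx)).add
    ((b.isIntegral_coe.mul (hσint a)).mul hy)).add
    ((b.isIntegral_coe.mul (hσint b)).mul (hint z₃)))
end

section
/- Let p be an odd prime, let d be an integer not divisible by p, and let n be an integer. Then the number of quadruples (c₁, c₂, d₁, d₂) ∈ (ℤ/p)⁴ satisfying c₁² + d·c₂² + c₁·d₂ − c₂·d₁ = n in ℤ/p equals p³ + p² − p if p divides n, and equals p³ − p if p does not divide n. -/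
/-- A nonzero linear form in two variables over a field takes each value along a line, whose
points are in bijection with the field. -/
theorem natCard_linear_form_fiber {K : Type*} [Field K] (u : K × K) (hu : u ≠ 0) (c : K) :
    Nat.card {w : K × K // u.1 * w.2 - u.2 * w.1 = c} = Nat.card K := by
  obtain ⟨a, b⟩ := u
  by_cases ha : a = 0
  · have hb : b ≠ 0 := by
      rintro rfl
      exact hu (by rw [ha]; rfl)
    refine Nat.card_congr
      { toFun := fun w => w.1.2
        invFun := fun t => ⟨((a * t - c) / b, t), by field_simp; ring⟩
        left_inv := ?_
        right_inv := fun t => rfl }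
    rintro ⟨⟨x, y⟩, h⟩
    refine Subtype.ext (Prod.ext ?_ rfl)
    change (a * y - c) / b = x
    rw [div_eq_iff hb]
    linear_combination h
  · refine Nat.card_congr
      { toFun := fun w => w.1.1
        invFun := fun t => ⟨(t, (c + b * t) / a), by field_simp; ring⟩
        left_inv := ?_
        right_inv := fun t => rfl }
    rintro ⟨⟨x, y⟩, h⟩
    refine Subtype.ext (Prod.ext rfl ?_)
    change (c + b * x) / a = y
    rw [div_eq_iff ha]
    linear_combination -h

/-- Solutions of the quaternary equation, fibered over their first two coordinates. -/
def curvatureFormFiberEquiv {K : Type*} [Field K] (d n : K) :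
    {v : Fin 4 → K // (v 0) ^ 2 + d * (v 1) ^ 2 + v 0 * v 3 - v 1 * v 2 = n} ≃
      Σ u : K × K, {w : K × K // u.1 * w.2 - u.2 * w.1 = n - u.1 ^ 2 - d * u.2 ^ 2} where
  toFun v := ⟨(v.1 0, v.1 1), (v.1 2, v.1 3), by linear_combination v.2⟩
  invFun s := ⟨![s.1.1, s.1.2, s.2.1.1, s.2.1.2], by
    change s.1.1 ^ 2 + d * s.1.2 ^ 2 + s.1.1 * s.2.1.2 - s.1.2 * s.2.1.1 = n
    linear_combination s.2.2⟩
  left_inv v := by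
    ext i
    fin_cases i <;> rfl
  right_inv s := rfl

open Classical in
theorem natCard_curvature_form {K : Type*} [Field K] [Finite K] (d n : K) :
    Nat.card {v : Fin 4 → K // (v 0) ^ 2 + d * (v 1) ^ 2 + v 0 * v 3 - v 1 * v 2 = n} =
      (if n = 0 then Nat.card K ^ 2 else 0) + (Nat.card K ^ 2 - 1) * Nat.card K := by
  have := Fintype.ofFinite K
  rw [Nat.card_congr (curvatureFormFiberEquiv d n), Nat.card_sigma,
    ← Finset.add_sum_erase _ _ (Finset.mem_univ (0 : K × K))]
  congr 1
  · split_ifs with hn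
    · simp [hn, sq]
    · simp [Ne.symm hn]
  · rw [Finset.sum_congr rfl fun u hu =>
      natCard_linear_form_fiber u (Finset.ne_of_mem_erase hu) _]
    simp [Finset.card_erase_of_mem, sq]


/-- For an odd prime `p`, `p ∤ d`, the number of solutions
`(c₁, c₂, d₁, d₂) ∈ (ℤ/p)⁴` of `c₁² + d·c₂² + c₁·d₂ − c₂·d₁ = n` is `p³ + p² − p` if `p ∣ n`
and `p³ − p` otherwise. -/
theorem curvature_form_solution_count (p : ℕ) (hp : p.Prime) (hodd : Odd p)
    (d n : ℤ) (hd : ¬ (p : ℤ) ∣ d) :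
    Nat.card {v : Fin 4 → ZMod p //
        (v 0) ^ 2 + (d : ZMod p) * (v 1) ^ 2 + v 0 * v 3 - v 1 * v 2 = (n : ZMod p)} =
      if (p : ℤ) ∣ n then p ^ 3 + p ^ 2 - p else p ^ 3 - p := by
  have := Fact.mk hp
  have hle : p ≤ p ^ 3 := Nat.le_self_pow (by norm_num) p
  have hmul : (p ^ 2 - 1) * p = p ^ 3 - p := by
    rw [Nat.sub_mul, one_mul, ← pow_succ]
  rw [natCard_curvature_form, Nat.card_zmod, hmul]
  simp only [ZMod.intCast_zmod_eq_zero_iff_dvd]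
  split_ifs <;> omega
end

section
/- Let p be an odd prime, let d be an integer not divisible by p, and let n be an integer. Let N be the number of tuples (a₁, a₂, b₁, b₂, c₁, c₂, d₁, d₂) ∈ (ℤ/p)⁸ satisfying the three equations in ℤ/p: (i) a₁d₁ − d·a₂d₂ − b₁c₁ + d·b₂c₂ = 1, (ii) a₁d₂ + a₂d₁ − b₁c₂ − b₂c₁ = 0, and (iii) c₁² + d·c₂² + c₁d₂ − c₂d₁ = n. If −d is not a square modulo p, then N = p²(p³ + p² − p − 1) when p divides n, and N = p²(p³ − p) when p does not divide n. If −d is a nonzero square modulo p, then N = p²(p³ − p² − p + 1) when p divides n, and N = p²(p³ − p) when p does not divide n. -/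
open QuadraticAlgebra

theorem card_quadraticAlgebra {F : Type*} (a b : F) :
    Nat.card (QuadraticAlgebra F a b) = Nat.card F ^ 2 := by
  rw [Nat.card_congr (equivProd a b), Nat.card_prod, sq]

/-- Consecutive coordinates of a vector in `F⁸` are the real and imaginary parts of the entries
of a `2 × 2` matrix over the quadratic algebra, listed row by row. -/
def matrixEntriesEquiv {F : Type*} (a b : F) :
    (Fin 8 → F) ≃ (QuadraticAlgebra F a b × QuadraticAlgebra F a b) ×
      (QuadraticAlgebra F a b × QuadraticAlgebra F a b) where
  toFun v := ((⟨v 0, v 1⟩, ⟨v 2, v 3⟩), (⟨v 4, v 5⟩, ⟨v 6, v 7⟩))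
  invFun M :=
    ![M.1.1.re, M.1.1.im, M.1.2.re, M.1.2.im, M.2.1.re, M.2.1.im, M.2.2.re, M.2.2.im]
  left_inv v := by
    ext i
    fin_cases i <;> rfl
  right_inv _ := rfl

theorem matrixEntriesEquiv_apply {F : Type*} (a b : F) (v : Fin 8 → F) :
    matrixEntriesEquiv a b v = ((⟨v 0, v 1⟩, ⟨v 2, v 3⟩), (⟨v 4, v 5⟩, ⟨v 6, v 7⟩)) := rfl

section CommRing

variable {R : Type*} [CommRing R]

/-- The `2 × 2` matrices of determinant one with a fixed coprime bottom row form a torsor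
under the additive group of the ring; this is the total space over all bottom rows in `P`. -/
theorem card_det_one_of_bottom_row (P : R × R → Prop) :
    Nat.card {M : (R × R) × (R × R) // M.1.1 * M.2.2 - M.1.2 * M.2.1 = 1 ∧ P M.2} =
      Nat.card {w : R × R // IsCoprime w.1 w.2 ∧ P w} * Nat.card R := by
  rw [← Nat.card_prod]
  have H (w : {w : R × R // IsCoprime w.1 w.2 ∧ P w}) :
      ∃ u : R × R, u.1 * w.1.2 - u.2 * w.1.1 = 1 := by
    obtain ⟨⟨c, d⟩, ⟨u, v, h⟩, -⟩ := w
    exact ⟨(v, -u), by linear_combination h⟩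
  choose f hf using H
  have hcop (M : {M : (R × R) × (R × R) // M.1.1 * M.2.2 - M.1.2 * M.2.1 = 1 ∧ P M.2}) :
      IsCoprime M.1.2.1 M.1.2.2 := ⟨-M.1.1.2, M.1.1.1, by linear_combination M.2.1⟩
  have hdet (w : {w : R × R // IsCoprime w.1 w.2 ∧ P w}) (t : R) :
      (f w + t • w.1).1 * w.1.2 - (f w + t • w.1).2 * w.1.1 = 1 := by
    simp only [Prod.fst_add, Prod.snd_add, Prod.smul_fst, Prod.smul_snd, smul_eq_mul]
    linear_combination hf w
  refine (Nat.card_congr ⟨fun x => ⟨(f x.1 + x.2 • x.1.1, x.1.1), hdet x.1 x.2, x.1.2.2⟩,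
    fun M => (⟨M.1.2, hcop M, M.2.2⟩, (f ⟨M.1.2, hcop M, M.2.2⟩).1 * M.1.1.2 -
      (f ⟨M.1.2, hcop M, M.2.2⟩).2 * M.1.1.1), ?_, ?_⟩).symm
  · rintro ⟨w, t⟩
    have := hf w
    refine Prod.ext rfl ?_
    simp only [Prod.fst_add, Prod.snd_add, Prod.smul_fst, Prod.smul_snd, smul_eq_mul]
    linear_combination t * this
  · rintro ⟨⟨⟨a, b⟩, c, d⟩, h, hP⟩
    have := hf ⟨(c, d), hcop ⟨((a, b), c, d), h, hP⟩, hP⟩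
    refine Subtype.ext (Prod.ext (Prod.ext ?_ ?_) rfl)
    · simp only [Prod.fst_add, Prod.smul_fst, smul_eq_mul] at this ⊢
      linear_combination a * this - (f _).1 * h
    · simp only [Prod.snd_add, Prod.smul_snd, smul_eq_mul] at this ⊢
      linear_combination b * this - (f _).2 * h

end CommRing

section Field

variable {F : Type*} [Field F]

instance [Finite F] (a b : F) : Finite (QuadraticAlgebra F a b) :=
  Finite.of_equiv _ (equivProd a b).symm

theorem card_linear_eq (a b : F) (c : QuadraticAlgebra F a b) (hc : c ≠ 0) (m : F) :
    Nat.card {x : QuadraticAlgebra F a b // c.re * x.im - c.im * x.re = m} = Nat.card F := by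
  by_cases h : c.re = 0
  · have h' : c.im ≠ 0 := fun h' => hc (QuadraticAlgebra.ext h h')
    refine Nat.card_congr ⟨fun x => x.1.im, fun t => ⟨⟨-m / c.im, t⟩, ?_⟩, ?_, fun _ => rfl⟩
    · simp only [h]
      field_simp
      ring
    · rintro ⟨x, rfl⟩
      refine Subtype.ext (QuadraticAlgebra.ext ?_ rfl)
      simp only [h]
      field_simp
      ring
  · refine Nat.card_congr
      ⟨fun x => x.1.re, fun t => ⟨⟨t, (m + c.im * t) / c.re⟩, ?_⟩, ?_, fun _ => rfl⟩
    · field_simp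
      ring
    · rintro ⟨x, rfl⟩
      refine Subtype.ext (QuadraticAlgebra.ext rfl ?_)
      field_simp
      ring

/-- The curvature form `c₁² + D c₂² + c₁ d₂ - c₂ d₁` of a bottom row `(c, d)`. -/
def curvatureForm (D : F) (w : QuadraticAlgebra F (-D) 0 × QuadraticAlgebra F (-D) 0) : F :=
  w.1.re ^ 2 + D * w.1.im ^ 2 + w.1.re * w.2.im - w.1.im * w.2.re

theorem card_curvatureForm_eq [Finite F] (D n : F) :
    Nat.card {w // curvatureForm D w = n} + Nat.card F =
      Nat.card F ^ 3 +
        Nat.card {_x : QuadraticAlgebra F (-D) 0 // 0 = n} := by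
  classical
  have := Fintype.ofFinite (QuadraticAlgebra F (-D) 0)
  have e : {w // curvatureForm D w = n} ≃
      Σ c : QuadraticAlgebra F (-D) 0, {x // curvatureForm D (c, x) = n} :=
    ⟨fun w => ⟨w.1.1, w.1.2, w.2⟩, fun x => ⟨(x.1, x.2.1), x.2.2⟩, fun _ => rfl, fun _ => rfl⟩
  have key (c : QuadraticAlgebra F (-D) 0) (hc : c ∈ Finset.univ.erase 0) :
      Nat.card {x // curvatureForm D (c, x) = n} = Nat.card F := by
    rw [← card_linear_eq (-D) 0 c (Finset.ne_of_mem_erase hc)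
      (n - (c.re ^ 2 + D * c.im ^ 2))]
    refine Nat.card_congr (Equiv.subtypeEquivRight fun x => ?_)
    rw [curvatureForm, eq_sub_iff_add_eq]
    ring_nf
  have hzero : Nat.card {x // curvatureForm D (0, x) = n} =
      Nat.card {_x : QuadraticAlgebra F (-D) 0 // 0 = n} :=
    Nat.card_congr (Equiv.subtypeEquivRight fun x => by simp [curvatureForm])
  have hcard := card_quadraticAlgebra (-D) (0 : F)
  rw [Nat.card_eq_fintype_card] at hcard
  rw [Nat.card_congr e, Nat.card_sigma, ← Finset.add_sum_erase _ _ (Finset.mem_univ 0),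
    Finset.sum_congr rfl key, hzero, Finset.sum_const, smul_eq_mul,
    Finset.card_erase_of_mem (Finset.mem_univ _), Finset.card_univ, hcard, add_assoc,
    ← Nat.succ_mul, Nat.succ_eq_add_one, Nat.sub_add_cancel (Nat.pow_pos Nat.card_pos)]
  ring

theorem card_curvatureForm_eq_zero [Finite F] (D : F) :
    Nat.card {w // curvatureForm D w = 0} + Nat.card F = Nat.card F ^ 3 + Nat.card F ^ 2 := by
  rw [card_curvatureForm_eq, ← card_quadraticAlgebra (-D) 0]
  simp

theorem card_curvatureForm_eq_of_ne_zero [Finite F] (D : F) {n : F} (hn : n ≠ 0) :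
    Nat.card {w // curvatureForm D w = n} + Nat.card F = Nat.card F ^ 3 := by
  rw [card_curvatureForm_eq]
  simp [hn.symm]

theorem isCoprime_iff_of_not_isSquare {D : F} (hD : ¬ IsSquare (-D))
    (c d : QuadraticAlgebra F (-D) 0) : IsCoprime c d ↔ ¬ (c = 0 ∧ d = 0) := by
  have : Fact (∀ r, r ^ 2 ≠ -D + 0 * r) :=
    ⟨fun r h => hD ⟨r, by linear_combination -h⟩⟩
  refine ⟨?_, fun h => ?_⟩
  · rintro ⟨u, v, h⟩ ⟨rfl, rfl⟩
    simp at h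
  · by_cases hc : c = 0
    · exact ⟨0, d⁻¹, by rw [zero_mul, zero_add, inv_mul_cancel₀ fun hd => h ⟨hc, hd⟩]⟩
    · exact ⟨c⁻¹, 0, by rw [zero_mul, add_zero, inv_mul_cancel₀ hc]⟩

theorem isCoprime_iff_of_sq_eq (h2 : (2 : F) ≠ 0) {D s : F} (hs0 : s ≠ 0) (hs : -D = s * s)
    (c d : QuadraticAlgebra F (-D) 0) :
    IsCoprime c d ↔ ¬ (c.re + s * c.im = 0 ∧ d.re + s * d.im = 0) ∧
      ¬ (c.re + -s * c.im = 0 ∧ d.re + -s * d.im = 0) := by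
  obtain rfl : D = -(s * s) := by rw [← hs, neg_neg]
  constructor
  · rintro ⟨u, v, h⟩
    have hre := congrArg QuadraticAlgebra.re h
    have him := congrArg QuadraticAlgebra.im h
    simp only [re_add, im_add, re_mul, im_mul, re_one, im_one] at hre him
    refine ⟨?_, ?_⟩ <;> rintro ⟨h1, h3⟩ <;> apply one_ne_zero (α := F)
    · linear_combination -hre - s * him + (u.re + s * u.im) * h1 + (v.re + s * v.im) * h3
    · linear_combination -hre + s * him + (u.re - s * u.im) * h1 + (v.re - s * v.im) * h3
  · have bezout {x y : F} (h : ¬ (x = 0 ∧ y = 0)) : ∃ u v : F, u * x + v * y = 1 := by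
      by_cases hx : x = 0
      · have hy : y ≠ 0 := fun hy => h ⟨hx, hy⟩
        exact ⟨0, y⁻¹, by field_simp; ring⟩
      · exact ⟨x⁻¹, 0, by field_simp; ring⟩
    rintro ⟨h, h'⟩
    obtain ⟨u, v, h⟩ := bezout h
    obtain ⟨u', v', h'⟩ := bezout h'
    refine ⟨⟨(u + u') / 2, (u - u') / (2 * s)⟩, ⟨(v + v') / 2, (v - v') / (2 * s)⟩, ?_⟩
    ext
    · simp only [re_add, re_mul, re_one]
      field_simp
      linear_combination h + h'
    · simp only [im_add, im_mul, im_one]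
      field_simp
      linear_combination h - h'

theorem ncard_eigenline_pairs (a b s : F) :
    {w : QuadraticAlgebra F a b × QuadraticAlgebra F a b |
      w.1.re + s * w.1.im = 0 ∧ w.2.re + s * w.2.im = 0}.ncard = Nat.card F ^ 2 := by
  rw [← Nat.card_coe_set_eq, sq, ← Nat.card_prod]
  refine Nat.card_congr ⟨fun w => (w.1.1.im, w.1.2.im),
    fun x => ⟨(⟨-s * x.1, x.1⟩, ⟨-s * x.2, x.2⟩), ?_⟩, ?_, fun _ => rfl⟩
  · constructor <;> simp
  · rintro ⟨⟨c, d⟩, hc, hd⟩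
    refine Subtype.ext (Prod.ext (QuadraticAlgebra.ext ?_ rfl) (QuadraticAlgebra.ext ?_ rfl))
    · simp only at hc ⊢
      linear_combination -hc
    · simp only at hd ⊢
      linear_combination -hd

theorem card_isCoprime_curvatureForm_of_not_isSquare [Finite F] {D : F}
    (hD : ¬ IsSquare (-D)) :
    Nat.card {w : QuadraticAlgebra F (-D) 0 × QuadraticAlgebra F (-D) 0 //
      IsCoprime w.1 w.2 ∧ curvatureForm D w = 0} + 1 + Nat.card F =
      Nat.card F ^ 3 + Nat.card F ^ 2 := by
  rw [← card_curvatureForm_eq_zero D]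
  congr 1
  have hset : {w : QuadraticAlgebra F (-D) 0 × QuadraticAlgebra F (-D) 0 |
      IsCoprime w.1 w.2 ∧ curvatureForm D w = 0} = {w | curvatureForm D w = 0} \ {0} := by
    ext w
    simp only [isCoprime_iff_of_not_isSquare hD, Set.mem_ofPred_eq, Set.mem_sdiff,
      Set.mem_singleton_iff, Prod.ext_iff, Prod.fst_zero, Prod.snd_zero]
    tauto
  have := Set.ncard_sdiff_singleton_add_one
    (show (0 : QuadraticAlgebra F (-D) 0 × QuadraticAlgebra F (-D) 0) ∈
      {w | curvatureForm D w = 0} by simp [curvatureForm])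
  rwa [← hset] at this

theorem card_isCoprime_curvatureForm_of_sq_eq [Finite F] (h2 : (2 : F) ≠ 0) {D s : F}
    (hs0 : s ≠ 0) (hs : -D = s * s) :
    Nat.card {w : QuadraticAlgebra F (-D) 0 × QuadraticAlgebra F (-D) 0 //
      IsCoprime w.1 w.2 ∧ curvatureForm D w = 0} + 2 * Nat.card F ^ 2 + Nat.card F =
      Nat.card F ^ 3 + Nat.card F ^ 2 + 1 := by
  rw [← card_curvatureForm_eq_zero D]
  let L (t : F) : Set (QuadraticAlgebra F (-D) 0 × QuadraticAlgebra F (-D) 0) :=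
    {w | w.1.re + t * w.1.im = 0 ∧ w.2.re + t * w.2.im = 0}
  have hset : {w : QuadraticAlgebra F (-D) 0 × QuadraticAlgebra F (-D) 0 |
      IsCoprime w.1 w.2 ∧ curvatureForm D w = 0} =
      {w | curvatureForm D w = 0} \ (L s ∪ L (-s)) := by
    ext w
    simp only [isCoprime_iff_of_sq_eq h2 hs0 hs, Set.mem_ofPred_eq, Set.mem_sdiff, L,
      Set.mem_union]
    tauto
  have hsub (t : F) (ht : -D = t * t) : L t ⊆ {w | curvatureForm D w = 0} := by
    rintro w ⟨h1, h3⟩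
    simp only [Set.mem_ofPred_eq, curvatureForm]
    linear_combination (w.1.re - t * w.1.im + w.2.im) * h1 - w.1.im * h3 - w.1.im ^ 2 * ht
  have hinter : L s ∩ L (-s) = {0} := by
    have aux {x y : F} (h : x + s * y = 0) (h' : x + -s * y = 0) : x = 0 ∧ y = 0 := by
      have hy : y = 0 := by
        have : (2 * s) * y = 0 := by linear_combination h - h'
        simpa [h2, hs0] using this
      subst hy
      simpa using h
    ext ⟨c, d⟩
    constructor
    · rintro ⟨⟨h1, h3⟩, h1', h3'⟩
      exact Prod.ext (QuadraticAlgebra.ext (aux h1 h1').1 (aux h1 h1').2)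
        (QuadraticAlgebra.ext (aux h3 h3').1 (aux h3 h3').2)
    · rintro ⟨rfl, rfl⟩
      simp [L]
  have hdiff := Set.ncard_sdiff_add_ncard_of_subset
    (Set.union_subset (hsub s hs) (hsub (-s) (by rw [neg_mul_neg, hs])))
  have hunion := Set.ncard_union_add_ncard_inter (L s) (L (-s))
  rw [hinter, Set.ncard_singleton, ncard_eigenline_pairs, ncard_eigenline_pairs] at hunion
  rw [← hset, ← Nat.card_coe_set_eq, ← Nat.card_coe_set_eq {w | curvatureForm D w = 0}] at hdiff
  simp only [Set.coe_ofPred] at hdiff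
  omega

theorem isCoprime_of_curvatureForm_ne_zero {D : F} (h2 : (2 : F) ≠ 0) (hD : D ≠ 0)
    {w : QuadraticAlgebra F (-D) 0 × QuadraticAlgebra F (-D) 0} (hw : curvatureForm D w ≠ 0) :
    IsCoprime w.1 w.2 := by
  by_cases h : IsSquare (-D)
  · obtain ⟨s, hs⟩ := h
    have hs0 : s ≠ 0 := by
      rintro rfl
      simp [hD] at hs
    rw [isCoprime_iff_of_sq_eq h2 hs0 hs]
    refine ⟨?_, ?_⟩ <;> rintro ⟨h1, h3⟩ <;> refine hw ?_ <;> rw [curvatureForm]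
    · linear_combination (w.1.re - s * w.1.im + w.2.im) * h1 - w.1.im * h3 - w.1.im ^ 2 * hs
    · linear_combination (w.1.re + s * w.1.im + w.2.im) * h1 - w.1.im * h3 - w.1.im ^ 2 * hs
  · rw [isCoprime_iff_of_not_isSquare h]
    rintro ⟨h1, h3⟩
    exact hw (by simp [curvatureForm, h1, h3])

theorem card_isCoprime_curvatureForm_of_ne_zero [Finite F] {D n : F} (h2 : (2 : F) ≠ 0)
    (hD : D ≠ 0) (hn : n ≠ 0) :
    Nat.card {w : QuadraticAlgebra F (-D) 0 × QuadraticAlgebra F (-D) 0 //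
      IsCoprime w.1 w.2 ∧ curvatureForm D w = n} + Nat.card F = Nat.card F ^ 3 := by
  rw [← card_curvatureForm_eq_of_ne_zero D hn]
  congr 1
  refine Nat.card_congr (Equiv.subtypeEquivRight fun w => and_iff_right_of_imp ?_)
  rintro rfl
  exact isCoprime_of_curvatureForm_ne_zero h2 hD hn

theorem card_variety_eq (D n : F) :
    Nat.card {v : Fin 8 → F //
      v 0 * v 6 - D * v 1 * v 7 - v 2 * v 4 + D * v 3 * v 5 = 1 ∧
      v 0 * v 7 + v 1 * v 6 - v 2 * v 5 - v 3 * v 4 = 0 ∧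
      (v 4) ^ 2 + D * (v 5) ^ 2 + v 4 * v 7 - v 5 * v 6 = n} =
    Nat.card {w : QuadraticAlgebra F (-D) 0 × QuadraticAlgebra F (-D) 0 //
      IsCoprime w.1 w.2 ∧ curvatureForm D w = n} * Nat.card F ^ 2 := by
  rw [← card_quadraticAlgebra (-D) 0, ← card_det_one_of_bottom_row]
  refine Nat.card_congr (Equiv.subtypeEquiv (matrixEntriesEquiv (-D) 0) fun v => ?_)
  simp only [matrixEntriesEquiv_apply, QuadraticAlgebra.ext_iff, re_sub, im_sub, re_mul, im_mul,
    re_one, im_one, curvatureForm, ← and_assoc]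
  ring_nf

end Field

/-- For an odd prime `p`, `p ∤ d`, the number of solutions
`(a₁, a₂, b₁, b₂, c₁, c₂, d₁, d₂) ∈ (ℤ/p)⁸` of the determinant equations and the curvature
equation, according to whether `−d` is a square mod `p` and whether `p ∣ n`. -/
theorem variety_point_count (p : ℕ) (hp : p.Prime) (hodd : Odd p)
    (d n : ℤ) (hd : ¬ (p : ℤ) ∣ d) :
    (¬ IsSquare (-(d : ZMod p)) →
      (((p : ℤ) ∣ n →
          Nat.card {v : Fin 8 → ZMod p //
              v 0 * v 6 - (d : ZMod p) * v 1 * v 7 - v 2 * v 4 + (d : ZMod p) * v 3 * v 5 = 1 ∧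
              v 0 * v 7 + v 1 * v 6 - v 2 * v 5 - v 3 * v 4 = 0 ∧
              (v 4) ^ 2 + (d : ZMod p) * (v 5) ^ 2 + v 4 * v 7 - v 5 * v 6 = (n : ZMod p)} =
            p ^ 2 * (p ^ 3 + p ^ 2 - p - 1)) ∧
        (¬ (p : ℤ) ∣ n →
          Nat.card {v : Fin 8 → ZMod p //
              v 0 * v 6 - (d : ZMod p) * v 1 * v 7 - v 2 * v 4 + (d : ZMod p) * v 3 * v 5 = 1 ∧
              v 0 * v 7 + v 1 * v 6 - v 2 * v 5 - v 3 * v 4 = 0 ∧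
              (v 4) ^ 2 + (d : ZMod p) * (v 5) ^ 2 + v 4 * v 7 - v 5 * v 6 = (n : ZMod p)} =
            p ^ 2 * (p ^ 3 - p)))) ∧
    (IsSquare (-(d : ZMod p)) →
      (((p : ℤ) ∣ n →
          Nat.card {v : Fin 8 → ZMod p //
              v 0 * v 6 - (d : ZMod p) * v 1 * v 7 - v 2 * v 4 + (d : ZMod p) * v 3 * v 5 = 1 ∧
              v 0 * v 7 + v 1 * v 6 - v 2 * v 5 - v 3 * v 4 = 0 ∧
              (v 4) ^ 2 + (d : ZMod p) * (v 5) ^ 2 + v 4 * v 7 - v 5 * v 6 = (n : ZMod p)} =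
            p ^ 2 * (p ^ 3 - p ^ 2 - p + 1)) ∧
        (¬ (p : ℤ) ∣ n →
          Nat.card {v : Fin 8 → ZMod p //
              v 0 * v 6 - (d : ZMod p) * v 1 * v 7 - v 2 * v 4 + (d : ZMod p) * v 3 * v 5 = 1 ∧
              v 0 * v 7 + v 1 * v 6 - v 2 * v 5 - v 3 * v 4 = 0 ∧
              (v 4) ^ 2 + (d : ZMod p) * (v 5) ^ 2 + v 4 * v 7 - v 5 * v 6 = (n : ZMod p)} =
            p ^ 2 * (p ^ 3 - p)))) := by
  have := Fact.mk hp
  have h2 : (2 : ZMod p) ≠ 0 := by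
    intro h
    have h' : ((2 : ℕ) : ZMod p) = 0 := by exact_mod_cast h
    rw [ZMod.natCast_eq_zero_iff, Nat.prime_dvd_prime_iff_eq hp Nat.prime_two] at h'
    subst h'
    exact absurd hodd (by decide)
  have hD : (d : ZMod p) ≠ 0 := by rwa [Ne, ZMod.intCast_zmod_eq_zero_iff_dvd]
  have hcard : Nat.card (ZMod p) = p := Nat.card_zmod p
  have hzero (h : (p : ℤ) ∣ n) : (n : ZMod p) = 0 := (ZMod.intCast_zmod_eq_zero_iff_dvd n p).2 h
  have hne (h : ¬ (p : ℤ) ∣ n) : (n : ZMod p) ≠ 0 := by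
    rwa [Ne, ZMod.intCast_zmod_eq_zero_iff_dvd]
  simp only [card_variety_eq, hcard, mul_comm _ (p ^ 2)]
  refine ⟨fun hsq => ⟨fun hn => ?_, fun hn => ?_⟩, fun hsq => ⟨fun hn => ?_, fun hn => ?_⟩⟩ <;>
    congr 1
  · have h := card_isCoprime_curvatureForm_of_not_isSquare hsq
    rw [hcard] at h
    rw [hzero hn]
    omega
  · have h := card_isCoprime_curvatureForm_of_ne_zero h2 hD (hne hn)
    rw [hcard] at h
    omega
  · obtain ⟨s, hs⟩ := hsq
    have hs0 : s ≠ 0 := by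
      rintro rfl
      simp [hD] at hs
    have h := card_isCoprime_curvatureForm_of_sq_eq h2 hs0 hs
    rw [hcard] at h
    rw [hzero hn]
    have hle : p ^ 2 + p ≤ p ^ 3 := by
      have := hp.two_le
      nlinarith [Nat.mul_le_mul_left (p ^ 2) this, Nat.mul_le_mul_left p this]
    omega
  · have h := card_isCoprime_curvatureForm_of_ne_zero h2 hD (hne hn)
    rw [hcard] at h
    omega
end

section
/- Let p be a prime with p ≥ 7, let m ≥ 1 be an integer, and let d be any integer. Then there exist x, y ∈ ℤ/p^m, both units, such that x² + d·y² = 1 in ℤ/p^m. -/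
theorem ZMod.isUnit_intCast_of_not_dvd {p : ℕ} (hp : p.Prime) (m : ℕ) {a : ℤ}
    (ha : ¬ (p : ℤ) ∣ a) : IsUnit (a : ZMod (p ^ m)) := by
  rw [ZMod.coe_int_isUnit_iff_isCoprime]
  push_cast
  exact ((Nat.prime_iff_prime_int.mp hp).coprime_iff_not_dvd.mpr ha).pow_left

/-- The rational parametrization of the conic `x² + d·y² = 1`, at a parameter `t` for which both
coordinates are units. -/
theorem exists_isUnit_sq_add_mul_sq_eq_one {R : Type*} [CommRing R] {d t : R}
    (h2 : IsUnit (2 : R)) (ht : IsUnit t) (h : IsUnit (1 - (d * t ^ 2) ^ 2)) :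
    ∃ x y : R, IsUnit x ∧ IsUnit y ∧ x ^ 2 + d * y ^ 2 = 1 := by
  have hfac : 1 - (d * t ^ 2) ^ 2 = (1 + d * t ^ 2) * (1 - d * t ^ 2) := by ring
  rw [hfac, IsUnit.mul_iff] at h
  obtain ⟨⟨u, hu⟩, hsub⟩ := h
  refine ⟨(1 - d * t ^ 2) * ↑u⁻¹, 2 * t * ↑u⁻¹, hsub.mul u⁻¹.isUnit,
    (h2.mul ht).mul u⁻¹.isUnit, ?_⟩
  have hinv : (1 + d * t ^ 2) * (↑u⁻¹ : R) = 1 := by rw [← hu, Units.mul_inv]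
  linear_combination ((1 + d * t ^ 2) * (↑u⁻¹ : R) + 1) * hinv

/-- For a prime `p ≥ 7`, `m ≥ 1` and any integer `d`, the equation
`x² + d·y² = 1` has a solution in units of `ℤ/p^m`. -/
theorem exists_unit_solution_norm_one (p m : ℕ) (hp : p.Prime) (hp7 : 7 ≤ p)
    (hm : 1 ≤ m) (d : ℤ) :
    ∃ x y : ZMod (p ^ m), IsUnit x ∧ IsUnit y ∧
      x ^ 2 + (d : ZMod (p ^ m)) * y ^ 2 = 1 := by
  have h2 : IsUnit (2 : ZMod (p ^ m)) := by
    have h : ¬ (p : ℤ) ∣ 2 := fun h => by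
      have := Int.le_of_dvd (by norm_num) h
      omega
    simpa using ZMod.isUnit_intCast_of_not_dvd hp m h
  by_cases hd : (p : ℤ) ∣ 1 - (d * 1 ^ 2) ^ 2
  · have h : ¬ (p : ℤ) ∣ 1 - (d * 2 ^ 2) ^ 2 := fun h => by
      have h15 : (p : ℤ) ∣ 15 := by
        have heq : (15 : ℤ) = 16 * (1 - (d * 1 ^ 2) ^ 2) - (1 - (d * 2 ^ 2) ^ 2) := by ring
        rw [heq]
        exact (hd.mul_left 16).sub h
      have h15' : p ∣ 3 * 5 := by exact_mod_cast h15
      rcases hp.dvd_mul.mp h15' with h' | h'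
      · have := Nat.le_of_dvd (by norm_num) h'
        omega
      · have := Nat.le_of_dvd (by norm_num) h'
        omega
    exact exists_isUnit_sq_add_mul_sq_eq_one h2 h2
      (by exact_mod_cast ZMod.isUnit_intCast_of_not_dvd hp m h)
  · exact exists_isUnit_sq_add_mul_sq_eq_one h2 isUnit_one
      (by exact_mod_cast ZMod.isUnit_intCast_of_not_dvd hp m hd)
end

section
/- Let M ∈ SL(2, ℂ). Suppose that for every 2×2 matrix v with real entries and trace 0, the matrix M v M⁻¹ has all entries real. Then either every entry of M is real, or every entry of M is purely imaginary (has real part 0). -/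
/-- If `z ≠ 0` has a real square, then the numbers whose product with `z` is real are all real
or all purely imaginary. -/
lemma Complex.im_eq_zero_or_re_eq_zero_of_im_mul_eq_zero {z : ℂ} (hz : z ≠ 0)
    (hzz : (z * z).im = 0) :
    (∀ w : ℂ, (z * w).im = 0 → w.im = 0) ∨ (∀ w : ℂ, (z * w).im = 0 → w.re = 0) := by
  have h : z.re * z.im = 0 := by
    rw [Complex.mul_im] at hzz
    linarith
  rcases mul_eq_zero.mp h with hre | him
  · right
    intro w hw
    have him : z.im ≠ 0 := fun him => hz (Complex.ext hre him)
    simpa [Complex.mul_im, hre, him] using hw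
  · left
    intro w hw
    have hre : z.re ≠ 0 := fun hre => hz (Complex.ext hre him)
    simpa [Complex.mul_im, hre, him] using hw

/-- If `M ∈ SL(2, ℂ)` conjugates every real trace-zero `2×2` matrix to a
matrix with real entries, then the entries of `M` are all real or all purely imaginary. -/
theorem stabilizer_of_real_sl2 (M : Matrix.SpecialLinearGroup (Fin 2) ℂ)
    (hM : ∀ v : Matrix (Fin 2) (Fin 2) ℝ, v.trace = 0 →
      ∀ i j, (((M : Matrix (Fin 2) (Fin 2) ℂ) * v.map (Complex.ofReal) *
        ((M⁻¹ : Matrix.SpecialLinearGroup (Fin 2) ℂ) : Matrix (Fin 2) (Fin 2) ℂ)) i j).im = 0) :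
    (∀ i j, ((M : Matrix (Fin 2) (Fin 2) ℂ) i j).im = 0) ∨
    (∀ i j, ((M : Matrix (Fin 2) (Fin 2) ℂ) i j).re = 0) := by
  have hdet : M.1 0 0 * M.1 1 1 - M.1 0 1 * M.1 1 0 = 1 := by
    rw [← Matrix.det_fin_two, M.2]
  have hE := hM !![0, 1; 0, 0] (by simp [Matrix.trace_fin_two])
  have hF := hM !![0, 0; 1, 0] (by simp [Matrix.trace_fin_two])
  have hH := hM !![1, 0; 0, -1] (by simp [Matrix.trace_fin_two])
  simp only [Matrix.SpecialLinearGroup.coe_inv, Matrix.adjugate_fin_two, Fin.forall_fin_two,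
    Matrix.mul_apply, Fin.sum_univ_two] at hE hF hH ⊢
  generalize M.1 0 0 = a, M.1 0 1 = b, M.1 1 0 = c, M.1 1 1 = d at *
  have hdet_im := congrArg Complex.im hdet
  simp at hE hF hH hdet_im
  by_cases ha : a = 0
  · have hb : b ≠ 0 := by
      rintro rfl
      simp [ha] at hdet
    have hbb : (b * b).im = 0 := by simp; linarith
    have hba : (b * a).im = 0 := by simp; linarith
    have hbc : (b * c).im = 0 := by simp; linarith
    have hbd : (b * d).im = 0 := by simp; linarith
    exact (Complex.im_eq_zero_or_re_eq_zero_of_im_mul_eq_zero hb hbb).imp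
      (fun h => ⟨⟨h a hba, h b hbb⟩, h c hbc, h d hbd⟩)
      (fun h => ⟨⟨h a hba, h b hbb⟩, h c hbc, h d hbd⟩)
  · have haa : (a * a).im = 0 := by simp; linarith
    have hab : (a * b).im = 0 := by simp; linarith
    have hac : (a * c).im = 0 := by simp; linarith
    have had : (a * d).im = 0 := by simp; linarith
    exact (Complex.im_eq_zero_or_re_eq_zero_of_im_mul_eq_zero ha haa).imp
      (fun h => ⟨⟨h a haa, h b hab⟩, h c hac, h d had⟩)
      (fun h => ⟨⟨h a haa, h b hab⟩, h c hac, h d had⟩)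
end

section
/- Let G be a finite group and S ⊆ G a finite symmetric generating set (s ∈ S implies s⁻¹ ∈ S, and S generates G). Let H be a subgroup of G of index l with l ≥ 2, and let h₀ > 0 be a real number. Assume that for every a ∈ G and every subset W of the left coset aH with 2·|W| ≤ |H|, the number of pairs (w, s) with w ∈ W, s ∈ S, and s·w ∈ aH \ W is at least h₀·|W|. Then for every subset V of G with 2·|V| ≤ |G|, the number of pairs (v, s) with v ∈ V, s ∈ S, and s·v ∉ V is at least min(9h₀/11, 1/(10·l²)) · |V|. -/
open scoped Classical in
/-- The pairs `(v, s) ∈ V × S` whose product `s * v` leaves `V`. -/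
noncomputable def edgeBoundary {G : Type*} [Group G] (S V : Finset G) : Finset (G × G) :=
  {vs ∈ V ×ˢ S | vs.2 * vs.1 ∉ V}

section

variable {G : Type*} [Group G]

theorem mem_edgeBoundary {S V : Finset G} {vs : G × G} :
    vs ∈ edgeBoundary S V ↔ vs.1 ∈ V ∧ vs.2 ∈ S ∧ vs.2 * vs.1 ∉ V := by
  simp [edgeBoundary, and_assoc]

/-- A nonempty set stable under a symmetric generating set of a transitively acting group is
everything. -/
theorem eq_univ_of_smul_mem_of_closure_eq_top {Q : Type*} [MulAction G Q]
    [MulAction.IsPretransitive G Q] {S : Set G} (hSsymm : ∀ s ∈ S, s⁻¹ ∈ S)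
    (hSgen : Subgroup.closure S = ⊤) {U : Set Q} (hne : U.Nonempty)
    (hU : ∀ s ∈ S, ∀ q ∈ U, s • q ∈ U) : U = Set.univ := by
  obtain ⟨q₀, hq₀⟩ := hne
  have key : ∀ g : G, ∀ q, g • q ∈ U ↔ q ∈ U := by
    intro g
    have hg : g ∈ Subgroup.closure S := hSgen ▸ Subgroup.mem_top g
    induction hg using Subgroup.closure_induction with
    | mem s hs =>
      exact fun q => ⟨fun h => by simpa using hU _ (hSsymm s hs) _ h, hU s hs q⟩
    | one => simp
    | mul x y _ _ hx hy => exact fun q => by rw [mul_smul, hx, hy]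
    | inv x _ hx => exact fun q => by rw [← hx, smul_inv_smul]
  refine Set.eq_univ_of_forall fun q => ?_
  obtain ⟨g, rfl⟩ := MulAction.exists_smul_eq G q₀ q
  exact (key g q₀).2 hq₀

/-- A function on a finite transitive `G`-set which drops by at most `B` along each generator drops
by at most `B` times the cardinality of the set overall. -/
theorem le_add_card_mul_of_le_smul_add {Q : Type*} [Fintype Q] [MulAction G Q]
    [MulAction.IsPretransitive G Q] {S : Set G} (hSsymm : ∀ s ∈ S, s⁻¹ ∈ S)
    (hSgen : Subgroup.closure S = ⊤) {f : Q → ℕ} {B : ℕ}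
    (hf : ∀ s ∈ S, ∀ q, f q ≤ f (s • q) + B) (p q : Q) :
    f p ≤ f q + Fintype.card Q * B := by
  classical
  let U : ℕ → Finset Q := fun k => {r | f p ≤ f r + k * B}
  have hmono (k : ℕ) : U k ⊆ U (k + 1) := by
    intro r hr
    simp only [U, Finset.mem_filter_univ] at hr ⊢
    linarith [Nat.zero_le B]
  have growth : ∀ k, U k = Finset.univ ∨ k < (U k).card := by
    intro k
    induction k with
    | zero => exact Or.inr (Finset.card_pos.2 ⟨p, by simp [U]⟩)
    | succ k ih =>
      by_cases huniv : U k = Finset.univ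
      · exact Or.inl (Finset.univ_subset_iff.1 (huniv ▸ hmono k))
      right
      have hk := ih.resolve_left huniv
      obtain ⟨s, hs, r, hr, hsr⟩ : ∃ s ∈ S, ∃ r ∈ U k, s • r ∉ U k := by
        by_contra! hstable
        refine huniv (Finset.coe_eq_univ.1 ?_)
        exact eq_univ_of_smul_mem_of_closure_eq_top hSsymm hSgen ⟨p, by simp [U]⟩ hstable
      have hsr' : s • r ∈ U (k + 1) := by
        simp only [U, Finset.mem_filter_univ] at hr ⊢
        linarith [hf s hs r]
      have hlt : (U k).card < (U (k + 1)).card :=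
        Finset.card_lt_card ((Finset.ssubset_iff_of_subset (hmono k)).2 ⟨_, hsr', hsr⟩)
      omega
  have hq : q ∈ U (Fintype.card Q) := by
    rcases growth (Fintype.card Q) with h | h
    · exact h ▸ Finset.mem_univ q
    · exact absurd h (Finset.card_le_univ _).not_gt
  simpa [U] using hq

open scoped Classical in
/-- The part of `V` in the left coset `q`. -/
noncomputable def cosetPart (H : Subgroup G) (V : Finset G) (q : G ⧸ H) : Finset G :=
  {v ∈ V | (v : G ⧸ H) = q}

theorem mem_cosetPart {H : Subgroup G} {V : Finset G} {q : G ⧸ H} {v : G} :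
    v ∈ cosetPart H V q ↔ v ∈ V ∧ (v : G ⧸ H) = q := by
  simp [cosetPart]

theorem sum_card_cosetPart (H : Subgroup G) [Fintype (G ⧸ H)] (V : Finset G) :
    ∑ q, (cosetPart H V q).card = V.card := by
  classical
  rw [Finset.card_eq_sum_card_fiberwise (f := fun v : G => (v : G ⧸ H)) (t := Finset.univ)
    (by simp)]
  exact Finset.sum_congr rfl fun q _ => by congr 1

theorem exists_eq_mul_iff_mk_eq (H : Subgroup G) (a x : G) :
    (∃ h ∈ H, x = a * h) ↔ (x : G ⧸ H) = a := by
  rw [eq_comm, QuotientGroup.eq]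
  exact ⟨by rintro ⟨h, hh, rfl⟩; simpa, fun h => ⟨_, h, by simp⟩⟩

theorem card_cosetPart_univ [Fintype G] (H : Subgroup G) (q : G ⧸ H) :
    (cosetPart H Finset.univ q).card = Nat.card H := by
  classical
  induction q using QuotientGroup.induction_on with
  | H a =>
    rw [← Nat.card_eq_finsetCard]
    refine Nat.card_congr (Equiv.symm ((Equiv.mulLeft a).subtypeEquiv fun h => ?_))
    rw [mem_cosetPart, ← exists_eq_mul_iff_mk_eq]
    simp

/-- Left multiplication by a generator moves the part of `V` in `q` into `s • q`, up to boundary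
pairs. -/
theorem card_cosetPart_le (H : Subgroup G) {S : Finset G} (V : Finset G) {s : G} (hs : s ∈ S)
    (q : G ⧸ H) :
    (cosetPart H V q).card ≤ (cosetPart H V (s • q)).card + (edgeBoundary S V).card := by
  classical
  rw [← Finset.card_filter_add_card_filter_not (s := cosetPart H V q) fun v => s * v ∈ V]
  refine add_le_add (Finset.card_le_card_of_injOn (s * ·) ?_ (mul_right_injective s).injOn)
    (Finset.card_le_card_of_injOn (·, s) ?_ fun _ _ _ _ h => (Prod.ext_iff.1 h).1)
  · intro v hv
    obtain ⟨hvq, hv⟩ := Finset.mem_filter.1 hv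
    refine mem_cosetPart.2 ⟨hv, ?_⟩
    rw [← (mem_cosetPart.1 hvq).2]
    rfl
  · intro v hv
    obtain ⟨hvq, hv⟩ := Finset.mem_filter.1 hv
    exact mem_edgeBoundary.2 ⟨(mem_cosetPart.1 hvq).1, hs, hv⟩

/-- Expansion of small subsets of a coset `q` bounds the boundary pairs of `V` starting in `q`, as
long as `V` fills at most `11/20` of `q`. -/
theorem mul_card_cosetPart_le [Fintype G] [DecidableEq G] {S : Finset G}
    (hSsymm : ∀ s ∈ S, s⁻¹ ∈ S) (H : Subgroup G) [DecidableEq (G ⧸ H)] {h₀ : ℝ} (hh₀ : 0 ≤ h₀)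
    {q : G ⧸ H}
    (hexp : ∀ W : Finset G, (∀ w ∈ W, (w : G ⧸ H) = q) → 2 * W.card ≤ Nat.card H →
      h₀ * W.card ≤
        ({ws ∈ edgeBoundary S W | ((ws.2 * ws.1 : G) : G ⧸ H) = q} : Finset (G × G)).card)
    {V : Finset G} (hV : 20 * (cosetPart H V q).card ≤ 11 * Nat.card H) :
    9 * h₀ / 11 * (cosetPart H V q).card ≤
      ({vs ∈ edgeBoundary S V | (vs.1 : G ⧸ H) = q} : Finset (G × G)).card := by
  by_cases hsmall : 2 * (cosetPart H V q).card ≤ Nat.card H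
  · have h₁ := hexp (cosetPart H V q) (fun w hw => (mem_cosetPart.1 hw).2) hsmall
    have h₂ : ({ws ∈ edgeBoundary S (cosetPart H V q) | ((ws.2 * ws.1 : G) : G ⧸ H) = q} :
        Finset (G × G)).card ≤
        ({vs ∈ edgeBoundary S V | (vs.1 : G ⧸ H) = q} : Finset (G × G)).card := by
      refine Finset.card_le_card fun ws => ?_
      simp only [Finset.mem_filter, mem_edgeBoundary, mem_cosetPart]
      tauto
    have h₃ : (0 : ℝ) ≤ h₀ * (cosetPart H V q).card := by positivity
    have h₄ := (Nat.cast_le (α := ℝ)).2 h₂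
    linarith
  · have hcompl : (cosetPart H V q).card + (cosetPart H Vᶜ q).card = Nat.card H := by
      rw [← card_cosetPart_univ H q, ← Finset.card_union_of_disjoint]
      · congr 1
        ext x
        simp only [Finset.mem_union, mem_cosetPart, Finset.mem_compl, Finset.mem_univ]
        tauto
      · refine Finset.disjoint_left.2 fun x => ?_
        simp only [mem_cosetPart, Finset.mem_compl]
        tauto
    have h₁ := hexp (cosetPart H Vᶜ q) (fun w hw => (mem_cosetPart.1 hw).2) (by omega)
    have h₂ : ({ws ∈ edgeBoundary S (cosetPart H Vᶜ q) | ((ws.2 * ws.1 : G) : G ⧸ H) = q} :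
        Finset (G × G)).card ≤
        ({vs ∈ edgeBoundary S V | (vs.1 : G ⧸ H) = q} : Finset (G × G)).card := by
      refine Finset.card_le_card_of_injOn (fun ws => (ws.2 * ws.1, ws.2⁻¹)) ?_ ?_
      · intro ws
        simp only [Finset.coe_filter, Set.mem_ofPred_eq, mem_edgeBoundary, mem_cosetPart,
          Finset.mem_compl, inv_mul_cancel_left]
        rintro ⟨⟨⟨hw, -⟩, hs, hsw⟩, hq⟩
        exact ⟨⟨by tauto, hSsymm _ hs, hw⟩, hq⟩
      · rintro ⟨w, s⟩ - ⟨w', s'⟩ - h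
        simp only [Prod.mk.injEq, inv_inj] at h
        obtain ⟨h, rfl⟩ := h
        simpa using h
    have h₃ : (9 : ℝ) * (cosetPart H V q).card ≤ 11 * (cosetPart H Vᶜ q).card := by
      exact_mod_cast (by omega)
    have h₄ := mul_le_mul_of_nonneg_left h₃ hh₀
    have h₅ := (Nat.cast_le (α := ℝ)).2 h₂
    linarith

end


/-- If every small subset of every left coset of a subgroup `H ≤ G` of index
`l ≥ 2` expands by a factor `h₀` under a symmetric generating set `S`, then every small subset
of `G` expands by a factor `min (9h₀/11) (1/(10l²))`. -/
theorem expansion_from_coset_expansion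
    (G : Type*) [Group G] [Finite G]
    (S : Finset G) (hSsymm : ∀ s ∈ S, s⁻¹ ∈ S)
    (hSgen : Subgroup.closure (S : Set G) = ⊤)
    (H : Subgroup G) (l : ℕ) (hl : H.index = l) (hl2 : 2 ≤ l)
    (h₀ : ℝ) (hh₀ : 0 < h₀)
    (hcoset : ∀ a : G, ∀ W : Finset G,
      (∀ w ∈ W, ∃ h ∈ H, w = a * h) →
      2 * W.card ≤ Nat.card H →
      h₀ * W.card ≤
        (Nat.card {ws : G × G // ws.1 ∈ W ∧ ws.2 ∈ S ∧
          (∃ h ∈ H, ws.2 * ws.1 = a * h) ∧ ws.2 * ws.1 ∉ W} : ℝ)) :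
    ∀ V : Finset G, 2 * V.card ≤ Nat.card G →
      min (9 * h₀ / 11) (1 / (10 * (l : ℝ) ^ 2)) * V.card ≤
        (Nat.card {vs : G × G // vs.1 ∈ V ∧ vs.2 ∈ S ∧ vs.2 * vs.1 ∉ V} : ℝ) := by
  classical
  intro V hV
  have := Fintype.ofFinite G
  have hB : Nat.card {vs : G × G // vs.1 ∈ V ∧ vs.2 ∈ S ∧ vs.2 * vs.1 ∉ V} =
      (edgeBoundary S V).card :=
    Nat.subtype_card _ fun _ => mem_edgeBoundary
  have hQ : Fintype.card (G ⧸ H) = l := by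
    rw [← Nat.card_eq_fintype_card, ← hl, Subgroup.index]
  rw [hB]
  by_cases hfull : ∀ q : G ⧸ H, 20 * (cosetPart H V q).card ≤ 11 * Nat.card H
  · have hexp (q : G ⧸ H) (W : Finset G) (hW : ∀ w ∈ W, (w : G ⧸ H) = q)
        (hcard : 2 * W.card ≤ Nat.card H) : h₀ * W.card ≤
        ({ws ∈ edgeBoundary S W | ((ws.2 * ws.1 : G) : G ⧸ H) = q} : Finset (G × G)).card := by
      obtain ⟨a, rfl⟩ := QuotientGroup.mk_surjective q
      refine (hcoset a W (fun w hw => (exists_eq_mul_iff_mk_eq H a w).2 (hW w hw))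
        hcard).trans_eq ?_
      refine congrArg _ (Nat.subtype_card _ fun ws => ?_)
      rw [Finset.mem_filter, mem_edgeBoundary, exists_eq_mul_iff_mk_eq]
      tauto
    calc min (9 * h₀ / 11) (1 / (10 * (l : ℝ) ^ 2)) * V.card
        ≤ 9 * h₀ / 11 * V.card := by gcongr; exact min_le_left _ _
      _ = ∑ q : G ⧸ H, 9 * h₀ / 11 * (cosetPart H V q).card := by
        rw [← Finset.mul_sum, ← sum_card_cosetPart H V, Nat.cast_sum]
      _ ≤ ∑ q : G ⧸ H,
          (({vs ∈ edgeBoundary S V | (vs.1 : G ⧸ H) = q} : Finset (G × G)).card : ℝ) :=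
        Finset.sum_le_sum fun q _ => mul_card_cosetPart_le hSsymm H hh₀.le (hexp q) (hfull q)
      _ = (edgeBoundary S V).card := by
        rw [Finset.card_eq_sum_card_fiberwise (f := fun vs : G × G => (vs.1 : G ⧸ H))
          (t := Finset.univ) (by simp), Nat.cast_sum]
  · push Not at hfull
    obtain ⟨p, hp⟩ := hfull
    have hdrop (q : G ⧸ H) :
        (cosetPart H V p).card ≤ (cosetPart H V q).card + l * (edgeBoundary S V).card :=
      hQ ▸ le_add_card_mul_of_le_smul_add hSsymm hSgen
        (f := fun q => (cosetPart H V q).card) (fun s hs q => card_cosetPart_le H V hs q) p q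
    have hsum : l * (cosetPart H V p).card ≤ V.card + l * (l * (edgeBoundary S V).card) := by
      have h := Finset.sum_le_sum fun q (_ : q ∈ Finset.univ) => hdrop q
      rwa [Finset.sum_add_distrib, sum_card_cosetPart, Finset.sum_const, Finset.sum_const,
        Finset.card_univ, hQ, smul_eq_mul, smul_eq_mul] at h
    have hG : Nat.card H * l = Nat.card G := hl ▸ H.card_mul_index
    have hbig : V.card ≤ 10 * l ^ 2 * (edgeBoundary S V).card := by nlinarith
    have hbig' : (V.card : ℝ) ≤ 10 * (l : ℝ) ^ 2 * (edgeBoundary S V).card := mod_cast hbig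
    calc min (9 * h₀ / 11) (1 / (10 * (l : ℝ) ^ 2)) * V.card
        ≤ 1 / (10 * (l : ℝ) ^ 2) * V.card := by gcongr; exact min_le_right _ _
      _ ≤ (edgeBoundary S V).card := by
        rw [one_div, inv_mul_le_iff₀ (by positivity)]
        exact hbig'
end
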